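/- arXiv:2106.09671 — 5 statements merged into one kernel-verified Lean document; each statement's English description precedes it below -/
import Mathlib

section
/- Let n be a natural number and let M be a real symmetric n×n matrix. Then there exist natural numbers p and q with p + q ≤ n, a real n×p matrix A, and a real n×q matrix R such that M = A * Aᵀ - R * Rᵀ. -/
open Matrix

/-- The spectral theorem for a real symmetric matrix, entrywise. -/
theorem Matrix.IsHermitian.apply_eq_sum_eigenvalues {ι : Type*} [Fintype ι] [DecidableEq ι]
    {M : Matrix ι ι ℝ} (hM : M.IsHermitian) (i j : ι) :
    M i j = ∑ k, hM.eigenvalues k *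
      ((hM.eigenvectorUnitary : Matrix ι ι ℝ) i k * (hM.eigenvectorUnitary : Matrix ι ι ℝ) j k) := by
  conv_lhs => rw [hM.spectral_theorem, Unitary.conjStarAlgAut_apply]
  rw [Matrix.mul_apply]
  refine Finset.sum_congr rfl fun k _ => ?_
  simp only [mul_diagonal, star_apply, Function.comp_apply, RCLike.ofReal_real_eq_id, id_eq,
    star_trivial]
  ring

theorem ar_decomposition_exists (n : ℕ) (M : Matrix (Fin n) (Fin n) ℝ)
    (hM : M.IsSymm) :
    ∃ (p q : ℕ), p + q ≤ n ∧
      ∃ (A : Matrix (Fin n) (Fin p) ℝ) (R : Matrix (Fin n) (Fin q) ℝ),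
        M = A * Aᵀ - R * Rᵀ := by
  have hH : M.IsHermitian := by rwa [IsHermitian, conjTranspose_eq_transpose_of_trivial]
  let U : Matrix (Fin n) (Fin n) ℝ := hH.eigenvectorUnitary
  let d := hH.eigenvalues
  let e := (Fintype.equivFin {k // 0 ≤ d k}).symm
  let f := (Fintype.equivFin {k // ¬ 0 ≤ d k}).symm
  refine ⟨Fintype.card {k // 0 ≤ d k}, Fintype.card {k // ¬ 0 ≤ d k}, ?_,
    Matrix.of fun i a => √(d (e a)) * U i (e a), Matrix.of fun i a => √(-d (f a)) * U i (f a), ?_⟩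
  · rw [← Fintype.card_sum, Fintype.card_congr (Equiv.sumCompl fun k => 0 ≤ d k), Fintype.card_fin]
  · ext i j
    simp only [Matrix.sub_apply, Matrix.mul_apply, transpose_apply, of_apply]
    rw [e.sum_comp fun k : {k // 0 ≤ d k} => √(d k) * U i k * (√(d k) * U j k),
      f.sum_comp fun k : {k // ¬ 0 ≤ d k} => √(-d k) * U i k * (√(-d k) * U j k),
      hH.apply_eq_sum_eigenvalues, ← Fintype.sum_subtype_add_sum_subtype (fun k => 0 ≤ d k),
      sub_eq_add_neg, ← Finset.sum_neg_distrib]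
    congr 1 <;> refine Finset.sum_congr rfl fun k _ => ?_
    · rw [mul_mul_mul_comm, Real.mul_self_sqrt k.2]
    · rw [mul_mul_mul_comm, Real.mul_self_sqrt (neg_nonneg.2 (not_le.1 k.2).le), neg_mul, neg_neg]
end

section
/- Let n be a natural number, let a b : Fin n → ℝ with a i > 0 and b i > 0 for all i, let J be the n×n matrix all of whose entries are 1, and let M be the 2n×2n block matrix fromBlocks (diagonal a) J J (diagonal b). Then the rank of M is at least 2n - 1; equivalently, the kernel of the linear map x ↦ M.mulVec x has dimension at most 1. -/
open Matrix

theorem block_matrix_rank_ge (n : ℕ) (a b : Fin n → ℝ)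
    (ha : ∀ i, 0 < a i) (hb : ∀ i, 0 < b i)
    (J : Matrix (Fin n) (Fin n) ℝ) (hJ : ∀ i j, J i j = 1)
    (M : Matrix (Fin n ⊕ Fin n) (Fin n ⊕ Fin n) ℝ)
    (hM : M = Matrix.fromBlocks (Matrix.diagonal a) J J (Matrix.diagonal b)) :
    2 * n - 1 ≤ M.rank ∧
      Module.finrank ℝ (LinearMap.ker M.mulVecLin) ≤ 1 := by
  -- On the kernel, the sum of the second block of coordinates determines the vector.
  let T : (Fin n ⊕ Fin n → ℝ) →ₗ[ℝ] ℝ := ∑ j, LinearMap.proj (Sum.inr j)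
  have hT : Function.Injective (T.domRestrict (LinearMap.ker M.mulVecLin)) := by
    rw [injective_iff_map_eq_zero]
    rintro ⟨v, hv⟩ hTv
    replace hTv : ∑ j, v (Sum.inr j) = 0 := by simpa [T] using hTv
    replace hv : M *ᵥ v = 0 := by simpa using hv
    have hl : ∀ i, v (Sum.inl i) = 0 := fun i ↦ by
      have h := congrFun hv (Sum.inl i)
      simpa [hM, mulVec, dotProduct, diagonal_apply, hJ, hTv, (ha i).ne'] using h
    have hr : ∀ i, v (Sum.inr i) = 0 := fun i ↦ by
      have h := congrFun hv (Sum.inr i)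
      simpa [hM, mulVec, dotProduct, diagonal_apply, hJ, hl, (hb i).ne'] using h
    ext (i | i)
    · exact hl i
    · exact hr i
  have hker : Module.finrank ℝ (LinearMap.ker M.mulVecLin) ≤ 1 := by
    simpa using LinearMap.finrank_le_finrank_of_injective hT
  refine ⟨?_, hker⟩
  have h := M.mulVecLin.finrank_range_add_finrank_ker
  simp only [Module.finrank_fintype_fun_eq_card, Fintype.card_sum, Fintype.card_fin] at h
  rw [Matrix.rank]
  omega
end

section
/- Let n be a natural number, let a b : Fin n → ℝ with a i > 0 and b i > 0 for all i, let J be the n×n matrix all of whose entries are 1, and let M be the 2n×2n block matrix fromBlocks (diagonal a) J J (diagonal b). If (∑ i, 1 / a i) * (∑ j, 1 / b j) ≠ 1, then M is nonsingular, i.e., det M ≠ 0 (equivalently, M has full rank 2n). -/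
open Matrix

theorem block_matrix_nonsingular (n : ℕ) (a b : Fin n → ℝ)
    (ha : ∀ i, 0 < a i) (hb : ∀ i, 0 < b i)
    (J : Matrix (Fin n) (Fin n) ℝ) (hJ : ∀ i j, J i j = 1)
    (M : Matrix (Fin n ⊕ Fin n) (Fin n ⊕ Fin n) ℝ)
    (hM : M = Matrix.fromBlocks (Matrix.diagonal a) J J (Matrix.diagonal b))
    (hr : (∑ i, 1 / a i) * (∑ j, 1 / b j) ≠ 1) :
    M.det ≠ 0 := by
  intro hdet
  obtain ⟨v, hv, hMv⟩ := Matrix.exists_mulVec_eq_zero_iff.mpr hdet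
  apply hv
  set S := ∑ i, v (Sum.inl i) with hS
  set T := ∑ j, v (Sum.inr j) with hT
  have hx : ∀ i, v (Sum.inl i) = -T * (1 / a i) := by
    intro i
    have h := congrFun hMv (Sum.inl i)
    simp [hM, Matrix.mulVec, dotProduct, hJ, Matrix.diagonal_apply] at h
    have := (ha i).ne'
    field_simp
    linarith
  have hy : ∀ j, v (Sum.inr j) = -S * (1 / b j) := by
    intro j
    have h := congrFun hMv (Sum.inr j)
    simp [hM, Matrix.mulVec, dotProduct, hJ, Matrix.diagonal_apply] at h
    have := (hb j).ne'
    field_simp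
    linarith
  have hSA : S = -T * ∑ i, 1 / a i := by
    rw [hS, Finset.mul_sum]
    exact Finset.sum_congr rfl fun i _ => hx i
  have hTB : T = -S * ∑ j, 1 / b j := by
    rw [hT, Finset.mul_sum]
    exact Finset.sum_congr rfl fun j _ => hy j
  have hS0 : S = 0 := by
    have h : S * ((∑ i, 1 / a i) * (∑ j, 1 / b j) - 1) = 0 := by
      linear_combination -hSA + (∑ i, 1 / a i) * hTB
    exact (mul_eq_zero.mp h).resolve_right (sub_ne_zero.mpr hr)
  have hT0 : T = 0 := by rw [hTB, hS0]; simp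
  ext (i | j)
  · rw [hx, hT0]; simp
  · rw [hy, hS0]; simp
end

section
/- Let n be a positive natural number, let a b : Fin n → ℝ with a i > 0 and b i > 0 for all i, let J be the n×n matrix all of whose entries are 1, and let M be the 2n×2n block matrix fromBlocks (diagonal a) J J (diagonal b). If (∑ i, 1 / a i) * (∑ j, 1 / b j) = 1, then the rank of M equals 2n - 1. -/
open Matrix

/-- A vector is in the kernel of `fromBlocks (diagonal a) J J' (diagonal b)`, with `J` and `J'` the
all-ones blocks, iff each entry is determined by the sum of the entries in the other block. -/
lemma mem_ker_mulVecLin_fromBlocks_diagonal_ones {ι κ K : Type*} [Fintype ι] [Fintype κ]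
    [DecidableEq ι] [DecidableEq κ] [Field K] {a : ι → K} {b : κ → K} (w : ι ⊕ κ → K) :
    w ∈ LinearMap.ker
        (fromBlocks (diagonal a) (of fun _ _ ↦ 1) (of fun _ _ ↦ 1) (diagonal b)).mulVecLin ↔
      (∀ i, a i * w (Sum.inl i) + ∑ j, w (Sum.inr j) = 0) ∧
        ∀ j, (∑ i, w (Sum.inl i)) + b j * w (Sum.inr j) = 0 := by
  simp [LinearMap.mem_ker, funext_iff, fromBlocks_mulVec, mulVec, dotProduct,
    diagonal_apply]

/-- If `(∑ i, 1 / a i) * (∑ j, 1 / b j) = 1`, the kernel of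
`fromBlocks (diagonal a) J J' (diagonal b)`, with all-ones blocks `J` and `J'`, is a line. -/
lemma ker_mulVecLin_fromBlocks_diagonal_ones {ι κ K : Type*} [Fintype ι] [Fintype κ]
    [DecidableEq ι] [DecidableEq κ] [Field K] {a : ι → K} {b : κ → K}
    (ha : ∀ i, a i ≠ 0) (hb : ∀ j, b j ≠ 0) (hr : (∑ i, 1 / a i) * (∑ j, 1 / b j) = 1) :
    LinearMap.ker
        (fromBlocks (diagonal a) (of fun _ _ ↦ 1) (of fun _ _ ↦ 1) (diagonal b)).mulVecLin =
      K ∙ (Sum.elim (fun i ↦ 1 / a i) fun j ↦ -(∑ i, 1 / a i) * (1 / b j)) := by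
  ext w
  rw [mem_ker_mulVecLin_fromBlocks_diagonal_ones, Submodule.mem_span_singleton]
  constructor
  · rintro ⟨hx, hy⟩
    have hx' (i) : w (Sum.inl i) = -(∑ j, w (Sum.inr j)) * (1 / a i) := by
      field_simp [ha i]
      linear_combination hx i
    have hX : ∑ i, w (Sum.inl i) = -(∑ j, w (Sum.inr j)) * ∑ i, 1 / a i := by
      rw [Finset.mul_sum]
      exact Finset.sum_congr rfl fun i _ ↦ hx' i
    have hy' (j) : w (Sum.inr j) = -(∑ i, w (Sum.inl i)) * (1 / b j) := by
      field_simp [hb j]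
      linear_combination hy j
    refine ⟨-∑ j, w (Sum.inr j), ?_⟩
    ext (i | j)
    · exact (hx' i).symm
    · rw [hy' j, hX]
      simp only [Pi.smul_apply, Sum.elim_inr, smul_eq_mul]
      ring
  · rintro ⟨c, rfl⟩
    simp only [Pi.smul_apply, Sum.elim_inl, Sum.elim_inr, smul_eq_mul, ← Finset.mul_sum]
    refine ⟨fun i ↦ ?_, fun j ↦ ?_⟩
    · linear_combination c * mul_one_div_cancel (ha i) - c * hr
    · linear_combination -c * (∑ i, 1 / a i) * mul_one_div_cancel (hb j)

/-- If `(∑ i, 1 / a i) * (∑ j, 1 / b j) = 1`, then `fromBlocks (diagonal a) J J' (diagonal b)`,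
with all-ones blocks `J` and `J'`, has corank one. -/
lemma rank_fromBlocks_diagonal_ones_add_one {ι κ K : Type*} [Fintype ι] [Fintype κ]
    [DecidableEq ι] [DecidableEq κ] [Field K] {a : ι → K} {b : κ → K}
    (ha : ∀ i, a i ≠ 0) (hb : ∀ j, b j ≠ 0) (hr : (∑ i, 1 / a i) * (∑ j, 1 / b j) = 1) :
    (fromBlocks (diagonal a) (of fun _ _ ↦ 1) (of fun _ _ ↦ 1) (diagonal b)).rank + 1 =
      Fintype.card ι + Fintype.card κ := by
  have hv : (Sum.elim (fun i ↦ 1 / a i) fun j ↦ -(∑ i, 1 / a i) * (1 / b j)) ≠ 0 := by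
    intro h
    have h_zero (i) : 1 / a i = 0 := congrFun h (Sum.inl i)
    simp [h_zero] at hr
  have h := LinearMap.finrank_range_add_finrank_ker
    (fromBlocks (diagonal a) (of fun _ _ ↦ 1) (of fun _ _ ↦ 1) (diagonal b)).mulVecLin
  rwa [ker_mulVecLin_fromBlocks_diagonal_ones ha hb hr, finrank_span_singleton hv,
    Module.finrank_fintype_fun_eq_card, Fintype.card_sum] at h

theorem block_matrix_rank_eq (n : ℕ) (hn : 0 < n) (a b : Fin n → ℝ)
    (ha : ∀ i, 0 < a i) (hb : ∀ i, 0 < b i)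
    (J : Matrix (Fin n) (Fin n) ℝ) (hJ : ∀ i j, J i j = 1)
    (M : Matrix (Fin n ⊕ Fin n) (Fin n ⊕ Fin n) ℝ)
    (hM : M = Matrix.fromBlocks (Matrix.diagonal a) J J (Matrix.diagonal b))
    (hr : (∑ i, 1 / a i) * (∑ j, 1 / b j) = 1) :
    M.rank = 2 * n - 1 := by
  obtain rfl : J = of fun _ _ ↦ 1 := Matrix.ext hJ
  have h := rank_fromBlocks_diagonal_ones_add_one (fun i ↦ (ha i).ne') (fun j ↦ (hb j).ne') hr
  rw [← hM, Fintype.card_fin] at h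
  lia
end

section
/- Let d, n, k be natural numbers, let B be a real symmetric d×d matrix, and let f : Fin n → Fin d be a surjective function such that every fiber of f contains at least two elements. Let X be a real n×k matrix whose rows are constant on the fibers of f (i.e., for all i, i' : Fin n, f i = f i' implies X i = X i' as functions Fin k → ℝ), and suppose that for all i ≠ j in Fin n, (X * Xᵀ) i j = B (f i) (f j). Then B is positive semidefinite; in particular, if B has a negative eigenvalue, no such X exists. -/
open Matrix

theorem sbm_offdiag_gram_forces_psd (d n k : ℕ) (B : Matrix (Fin d) (Fin d) ℝ)
    (hB : B.IsSymm) (f : Fin n → Fin d) (hf : Function.Surjective f)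
    (hfib : ∀ c : Fin d, ∃ i i' : Fin n, i ≠ i' ∧ f i = c ∧ f i' = c)
    (X : Matrix (Fin n) (Fin k) ℝ)
    (hconst : ∀ i i' : Fin n, f i = f i' → X i = X i')
    (hoff : ∀ i j : Fin n, i ≠ j → (X * Xᵀ) i j = B (f i) (f j)) :
    B.PosSemidef := by
  choose g hg using hf
  have hgram : B = X.submatrix g id * (X.submatrix g id)ᴴ := by
    ext a b
    obtain ⟨i, j, hij, hi, hj⟩ : ∃ i j, i ≠ j ∧ f i = a ∧ f j = b := by
      by_cases hab : a = b
      · subst hab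
        exact hfib a
      · exact ⟨g a, g b, fun h => hab (by rw [← hg a, ← hg b, h]), hg a, hg b⟩
    have hXi : X (g a) = X i := hconst _ _ ((hg a).trans hi.symm)
    have hXj : X (g b) = X j := hconst _ _ ((hg b).trans hj.symm)
    rw [← hi, ← hj, ← hoff i j hij, hi, hj]
    simp [mul_apply, hXi, hXj]
  rw [hgram]
  exact posSemidef_self_mul_conjTranspose _
end
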